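/- Let F = ℚ(a, t) be the field of rational functions in two variables a, t over ℚ and fix γ ∈ F. Define ψ′ from Young diagrams to F by ψ′_λ = γ^{|λ|} · ∏_{□∈λ} (a t^{c(□)} − a^{−1} t^{−c(□)}) / (t^{h(□)} − t^{−h(□)}). Then ψ′_∅ = 1 and for every nonempty Young diagram μ, (t − t^{−1}) · C_μ(t) · ψ′_μ = γ · Σ_{λ : λ+□=μ} (a t^{2 c(μ∖λ)} − a^{−1}) · ψ′_λ, where c(μ∖λ) denotes the content of the unique cell of μ not in λ. (This is the algebraic content of the second skein-valued recursion (◯ − P_{1,0} − γ(a_L a^{−1} P_{0,1} − a P_{1,1}))Ψ′ = 0 for the unknot conormal, written in the basis W_λ.) -/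

import Mathlib

open Finset

/-- The content of a cell `(i, j)` (0-indexed) of a Young diagram: `j - i`. -/
def cellContent (c : ℕ × ℕ) : ℤ := (c.2 : ℤ) - (c.1 : ℤ)

/-- The arm length of a cell: number of cells strictly to its right in its row. -/
def armLen (μ : YoungDiagram) (c : ℕ × ℕ) : ℕ := μ.rowLen c.1 - (c.2 + 1)

/-- The leg length of a cell: number of cells strictly below it in its column. -/
def legLen (μ : YoungDiagram) (c : ℕ × ℕ) : ℕ := μ.colLen c.2 - (c.1 + 1)

/-- The hook length of a cell: arm + leg + 1. -/
def hookLen (μ : YoungDiagram) (c : ℕ × ℕ) : ℕ := armLen μ c + legLen μ c + 1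

/-- `AddCell l m` means `m` is obtained from `l` by adding exactly one cell. -/
def AddCell (l m : YoungDiagram) : Prop := l.cells ⊆ m.cells ∧ m.card = l.card + 1

/-- The content of the unique cell of `m` not in `l` (when `AddCell l m`),
expressed as the sum over the one-element difference `m \ l`. -/
def newContent (l m : YoungDiagram) : ℤ := ∑ c ∈ m.cells \ l.cells, cellContent c

/-- The field `ℚ(a,t)` of rational functions in two variables over `ℚ`, realized as
rational functions in `t` over the field `ℚ(a)`. -/
abbrev F2 : Type := RatFunc (RatFunc ℚ)

/-- The variable `a` of `ℚ(a,t)`. -/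
noncomputable def va : F2 := RatFunc.C RatFunc.X

/-- The variable `t` of `ℚ(a,t)`. -/
noncomputable def vt : F2 := RatFunc.X

/-- The content polynomial `c_μ(q) = Σ_{□∈μ} q^{c(□)}` evaluated at `q = t²`,
as an element of `ℚ(a,t)`. -/
noncomputable def contentPolyT2 (μ : YoungDiagram) : F2 :=
  ∑ c ∈ μ.cells, vt ^ (2 * cellContent c)

/-- The second hook-content solution
`ψ'_λ = γ^{|λ|} ∏_{□∈λ} (a t^{c(□)} - a⁻¹ t^{-c(□)})/(t^{h(□)} - t^{-h(□)})`
for the unknot conormal. -/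
noncomputable def psiUnknot' (γ : F2) (l : YoungDiagram) : F2 :=
  γ ^ l.card * ∏ c ∈ l.cells,
    (va * vt ^ cellContent c - va⁻¹ * vt ^ (-cellContent c)) /
      (vt ^ (hookLen l c : ℤ) - vt ^ (-(hookLen l c : ℤ)))


theorem hl_two {ι : Type*} [DecidableEq ι] {K : Type*} [Field K] (s : Finset ι) (Z : ι → K)
    (hZ : Set.InjOn Z s) (q : K) (hq : q ≠ 1) :
    ∑ k ∈ s, Z k * ∏ j ∈ s.erase k, ((Z k - q * Z j) / (Z k - Z j)) = ∑ k ∈ s, Z k := by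
  rcases s.eq_empty_or_nonempty with rfl | hs
  · simp
  classical
  have key := Lagrange.coeff_eq_sum (s := s) (v := Z) hZ
    (P := ∏ j ∈ s, (Polynomial.X - Polynomial.C (q * Z j)) -
      ∏ j ∈ s, (Polynomial.X - Polynomial.C (Z j))) ?_
  · rw [Polynomial.coeff_sub, Polynomial.prod_X_sub_C_coeff_card_pred _ _ hs.card_pos,
      Polynomial.prod_X_sub_C_coeff_card_pred _ _ hs.card_pos] at key
    have h1 : 1 - q ≠ 0 := sub_ne_zero.2 (Ne.symm hq)
    apply mul_left_cancel₀ h1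
    rw [← Finset.mul_sum] at key
    have : (1 - q) * ∑ k ∈ s, Z k = -(q * ∑ i ∈ s, Z i) - -∑ i ∈ s, Z i := by ring
    rw [this, key, Finset.mul_sum]
    apply Finset.sum_congr rfl
    intro k hk
    rw [Polynomial.eval_sub, Polynomial.eval_prod, Polynomial.eval_prod,
      ← Finset.mul_prod_erase s (fun j => Polynomial.eval (Z k) (Polynomial.X - Polynomial.C (Z j))) hk,
      ← Finset.mul_prod_erase s (fun j => Polynomial.eval (Z k) (Polynomial.X - Polynomial.C (q * Z j))) hk, Finset.prod_div_distrib]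
    simp
    ring
  · refine lt_of_lt_of_eq (Polynomial.degree_sub_lt_left ?_ ?_ ?_) ?_
    · simp only [Polynomial.degree_prod, Polynomial.degree_X_sub_C]
    · exact Polynomial.Monic.ne_zero (Polynomial.monic_prod_X_sub_C _ _)
    · rw [(Polynomial.monic_prod_X_sub_C _ _).leadingCoeff, (Polynomial.monic_prod_X_sub_C _ _).leadingCoeff]
    · simp only [Polynomial.degree_prod, Polynomial.degree_X_sub_C]; simp

theorem hl_one {ι : Type*} [DecidableEq ι] {K : Type*} [Field K] (s : Finset ι) (Z : ι → K)
    (hZ : Set.InjOn Z s) (hZ0 : ∀ i ∈ s, Z i ≠ 0) (q : K) :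
    (1 - q) * ∑ k ∈ s, ∏ j ∈ s.erase k, ((Z k - q * Z j) / (Z k - Z j)) = 1 - q ^ s.card := by
  classical
  have hinj : Set.InjOn (fun o : Option ι => o.elim 0 Z) (Finset.insertNone s) := by
    rintro (_ | a) ha (_ | b) hb h
    · rfl
    · exact absurd h.symm (hZ0 b (by simpa using hb))
    · exact absurd h (hZ0 a (by simpa using ha))
    · simp at ha hb h
      rw [hZ ha hb h]
  have key := Lagrange.coeff_eq_sum (s := Finset.insertNone s) (v := fun o => o.elim 0 Z) hinj
    (P := ∏ j ∈ s, (Polynomial.X - Polynomial.C (q * Z j))) ?_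
  · have hc : (insertNone s).card - 1 = (∏ j ∈ s, (Polynomial.X - Polynomial.C (q * Z j))).natDegree := by
      rw [Polynomial.natDegree_finsetProd_X_sub_C_eq_card]; simp
    rw [hc, Polynomial.coeff_natDegree, (Polynomial.monic_prod_X_sub_C _ _).leadingCoeff,
      Finset.sum_insertNone] at key
    have e0 : (insertNone s).erase none = s.map Function.Embedding.some := by
      ext (_|x) <;> simp
    have ek : ∀ k, (insertNone s).erase (some k) = insertNone (s.erase k) := by
      intro k; ext (_|x) <;> simp
    simp only [e0, ek, Finset.prod_insertNone, Finset.prod_map, Polynomial.eval_prod] at key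
    simp only [Option.elim, Function.Embedding.some_apply, Polynomial.eval_sub, Polynomial.eval_X,
      Polynomial.eval_C, zero_sub, sub_zero, ← Finset.prod_div_distrib, neg_div_neg_eq] at key
    have e1 : ∏ x ∈ s, (q * Z x / Z x) = q ^ s.card := by
      rw [← Finset.prod_const]
      exact Finset.prod_congr rfl fun i hi => mul_div_cancel_right₀ _ (hZ0 i hi)
    rw [e1] at key
    rw [Finset.mul_sum, eq_sub_iff_add_eq, add_comm]
    refine Eq.trans ?_ key.symm
    congr 1
    apply Finset.sum_congr rfl
    intro k hk
    rw [← Finset.mul_prod_erase s _ hk, Finset.prod_div_distrib]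
    have := hZ0 k hk
    rw [show Z k - q * Z k = Z k * (1 - q) by ring, mul_assoc, mul_div_mul_left _ _ this, mul_div_assoc]
  · simp only [Polynomial.degree_prod, Polynomial.degree_X_sub_C]
    simp
    exact_mod_cast Nat.lt_succ_self _

noncomputable def br (n : ℤ) : F2 := vt ^ n - vt ^ (-n)

theorem vt_ne : vt ≠ 0 := RatFunc.X_ne_zero

theorem vt_pow_ne (n : ℕ) (hn : n ≠ 0) : vt ^ n ≠ 1 := by
  intro h
  rw [vt, ← RatFunc.algebraMap_X, ← map_pow, ← map_one (algebraMap (Polynomial (RatFunc ℚ)) F2)] at h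
  have := RatFunc.algebraMap_injective _ h
  have := congrArg Polynomial.natDegree this
  simp at this
  exact hn this

theorem vt_zpow_ne (n : ℤ) (hn : n ≠ 0) : vt ^ n ≠ 1 := by
  obtain ⟨m, rfl | rfl⟩ := n.eq_nat_or_neg
  · rw [zpow_natCast]; exact vt_pow_ne m (by simpa using hn)
  · rw [zpow_neg, zpow_natCast, inv_ne_one]; exact vt_pow_ne m (by simpa using hn)

theorem br_eq (n : ℤ) : br n = vt ^ (-n) * (vt ^ (2 * n) - 1) := by
  rw [br, mul_sub, ← zpow_add₀ vt_ne]; congr 2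
  · ring
  · simp

theorem br_ne (n : ℤ) (hn : n ≠ 0) : br n ≠ 0 := by
  rw [br_eq]
  exact mul_ne_zero (zpow_ne_zero _ vt_ne) (sub_ne_zero.2 (vt_zpow_ne _ (by omega)))

theorem br_neg (n : ℤ) : br (-n) = - br n := by simp [br]

theorem br_zero : br 0 = 0 := by simp [br]

theorem vt_inj {m n : ℤ} (h : vt ^ m = vt ^ n) : m = n := by
  by_contra hne
  apply vt_zpow_ne (m - n) (by omega)
  rw [zpow_sub₀ vt_ne, h, div_self (zpow_ne_zero _ vt_ne)]

theorem sum_identity (N : ℕ) (L : ℕ → ℤ) (hL : Set.InjOn L (Finset.range N)) :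
    ∑ k ∈ range N, vt ^ (L k - 1) * (br (L k - 1 + N) *
      ∏ j ∈ (range N).erase k, (br (L k - 1 - L j) / br (L k - L j))) =
    vt⁻¹ * ∑ i ∈ range N, (vt ^ (2 * L i) - vt ^ (-2 * (i : ℤ))) := by
  have hv := vt_ne
  have hq : vt ^ (2 : ℤ) ≠ 1 := vt_zpow_ne 2 (by norm_num)
  have hinj : Set.InjOn (fun i => vt ^ (2 * L i)) (range N) := by
    intro a ha b hb h
    apply hL ha hb
    have := vt_inj h
    omega
  have h2 := hl_two (range N) (fun i => vt ^ (2 * L i)) hinj (vt ^ (2 : ℤ)) hq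
  have h1 := hl_one (range N) (fun i => vt ^ (2 * L i)) hinj (fun i _ => zpow_ne_zero _ hv) (vt ^ (2 : ℤ))
  have h1' : ∑ k ∈ range N, ∏ j ∈ (range N).erase k,
      ((vt ^ (2 * L k) - vt ^ (2:ℤ) * vt ^ (2 * L j)) / (vt ^ (2 * L k) - vt ^ (2 * L j))) =
      ∑ i ∈ range N, (vt ^ (2:ℤ)) ^ i := by
    apply mul_left_cancel₀ (sub_ne_zero.2 hq.symm)
    rw [h1, card_range, mul_neg_geom_sum]
  rw [← Finset.sum_range_reflect (fun i => (vt ^ (2:ℤ)) ^ i)] at h1'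
  have fac : ∀ k ∈ range N, vt ^ (L k - 1) * (br (L k - 1 + N) *
      ∏ j ∈ (range N).erase k, (br (L k - 1 - L j) / br (L k - L j))) =
      vt⁻¹ * (vt ^ (2 * L k) * ∏ j ∈ (range N).erase k,
      ((vt ^ (2 * L k) - vt ^ (2:ℤ) * vt ^ (2 * L j)) / (vt ^ (2 * L k) - vt ^ (2 * L j)))) -
      vt ^ (1 - 2 * (N : ℤ)) * ∏ j ∈ (range N).erase k,
      ((vt ^ (2 * L k) - vt ^ (2:ℤ) * vt ^ (2 * L j)) / (vt ^ (2 * L k) - vt ^ (2 * L j))) := by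
    intro k hk
    have e : ∀ j ∈ (range N).erase k, br (L k - 1 - L j) / br (L k - L j) =
        vt⁻¹ * ((vt ^ (2 * L k) - vt ^ (2:ℤ) * vt ^ (2 * L j)) / (vt ^ (2 * L k) - vt ^ (2 * L j))) := by
      intro j hj
      have hne : L k - L j ≠ 0 := by
        intro h
        exact (mem_erase.1 hj).1 (hL (mem_erase.1 hj).2 hk (by omega))
      have hb : br (L k - L j) = vt ^ (-(L k) - L j) * (vt ^ (2 * L k) - vt ^ (2 * L j)) := by
        rw [br, mul_sub, ← zpow_add₀ hv, ← zpow_add₀ hv]; congr 2 <;> ring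
      have hb' : br (L k - 1 - L j) = vt⁻¹ * (vt ^ (-(L k) - L j) * (vt ^ (2 * L k) - vt ^ (2:ℤ) * vt ^ (2 * L j))) := by
        rw [br, ← zpow_neg_one, mul_sub, mul_sub, ← zpow_add₀ hv, ← zpow_add₀ hv, ← zpow_add₀ hv,
          ← zpow_add₀ hv, ← zpow_add₀ hv]; congr 2 <;> ring
      rw [hb, hb', mul_div_assoc, mul_div_mul_left _ _ (zpow_ne_zero _ hv)]
    rw [Finset.prod_congr rfl e, Finset.prod_mul_distrib, Finset.prod_const, card_erase_of_mem hk, card_range]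
    have hN : 1 ≤ N := by have := mem_range.1 hk; omega
    have e3 : vt ^ (L k - 1) * (br (L k - 1 + N) * vt⁻¹ ^ (N - 1)) =
        vt⁻¹ * vt ^ (2 * L k) - vt ^ (1 - 2 * (N : ℤ)) := by
      rw [br, ← zpow_natCast, inv_zpow', ← zpow_neg_one, sub_mul, mul_sub, ← zpow_add₀ hv, ← zpow_add₀ hv, ← zpow_add₀ hv,
          ← zpow_add₀ hv, ← zpow_add₀ hv]
      push_cast [hN]
      congr 2 <;> ring
    rw [← mul_assoc (vt⁻¹), ← sub_mul, ← e3]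
    ring
  rw [Finset.sum_congr rfl fac, Finset.sum_sub_distrib, ← Finset.mul_sum, ← Finset.mul_sum, h2, h1',
    Finset.sum_sub_distrib, mul_sub]
  congr 1
  rw [Finset.mul_sum, Finset.mul_sum]
  apply Finset.sum_congr rfl
  intro i hi
  have := mem_range.1 hi
  rw [← zpow_natCast, ← zpow_mul, ← zpow_neg_one, ← zpow_add₀ hv, ← zpow_add₀ hv]
  congr 1
  rw [Nat.cast_sub (by omega), Nat.cast_sub (by omega)]
  push_cast
  ring

theorem br_tele (A : ℤ) (m M : ℕ) (hm : m ≤ M) (hA : (M : ℤ) < A) :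
    ∏ j ∈ Ico m M, (br (A - j) / br (A - j - 1)) = br (A - m) / br (A - M) := by
  induction M, hm using Nat.le_induction with
  | base => simp [div_self (br_ne (A - m) (by omega))]
  | succ M hM ih =>
    rw [Finset.prod_Ico_succ_top hM, ih (by push_cast at hA; omega), div_mul_div_cancel₀]
    · push_cast; ring_nf
    · exact br_ne _ (by push_cast at hA; omega)

def ell (μ : YoungDiagram) (i : ℕ) : ℤ := (μ.rowLen i : ℤ) - i

theorem ell_lt (μ : YoungDiagram) {i j : ℕ} (h : i < j) : ell μ j < ell μ i := by
  have := μ.rowLen_anti i j h.le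
  unfold ell; omega

theorem ell_inj (μ : YoungDiagram) : Function.Injective (ell μ) := by
  intro i j h
  rcases lt_trichotomy i j with h1 | h1 | h1
  · have := ell_lt μ h1; omega
  · exact h1
  · have := ell_lt μ h1; omega

theorem hook_cast (μ : YoungDiagram) {i j : ℕ} (h : (i, j) ∈ μ) :
    (hookLen μ (i, j) : ℤ) = μ.rowLen i - j + μ.colLen j - i - 1 := by
  have h1 := YoungDiagram.mem_iff_lt_rowLen.1 h
  have h2 := YoungDiagram.mem_iff_lt_colLen.1 h
  simp only [hookLen, armLen, legLen]
  omega

theorem colLen_block (μ : YoungDiagram) {i j : ℕ} (h1 : j < μ.rowLen i) (h2 : μ.rowLen (i + 1) ≤ j) :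
    μ.colLen j = i + 1 := by
  have a := YoungDiagram.mem_iff_lt_colLen.1 (YoungDiagram.mem_iff_lt_rowLen.2 h1)
  have b : ¬ (i + 1 < μ.colLen j) := fun h => by
    have := YoungDiagram.mem_iff_lt_rowLen.1 (YoungDiagram.mem_iff_lt_colLen.2 h)
    omega
  omega

theorem row_tele (μ : YoungDiagram) (r s : ℕ) (hs : μ.rowLen r = s + 1) (hr : μ.rowLen (r + 1) ≤ s)
    (n : ℕ) :
    ∏ j ∈ Ico (μ.rowLen (r + 1 + n)) s, (br (hookLen μ (r, j)) / br (hookLen μ (r, j) - 1)) =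
    (∏ p ∈ Ico (r + 1) (r + 1 + n + 1), br (ell μ r - 1 - ell μ p)) /
      (br 1 * ∏ p ∈ Ico (r + 1) (r + 1 + n), br (ell μ r - ell μ p)) := by
  have block : ∀ i M, r ≤ i → μ.rowLen (i + 1) ≤ M → M ≤ s → M ≤ μ.rowLen i →
      ∏ j ∈ Ico (μ.rowLen (i + 1)) M, (br (hookLen μ (r, j)) / br (hookLen μ (r, j) - 1)) =
      br (ell μ r - 1 - ell μ (i + 1)) / br ((s : ℤ) + 1 + i - r - M) := by
    intro i M hi h1 h2 h3
    have := br_tele ((s : ℤ) + 1 + i - r) (μ.rowLen (i + 1)) M h1 (by omega)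
    refine Eq.trans (Finset.prod_congr rfl ?_) (this.trans ?_)
    · intro j hj
      obtain ⟨hj1, hj2⟩ := Finset.mem_Ico.1 hj
      have e := colLen_block μ (lt_of_lt_of_le hj2 h3) hj1
      have hk := hook_cast μ (i := r) (j := j) (YoungDiagram.mem_iff_lt_rowLen.2 (by omega))
      rw [hk, e, hs]
      congr 2 <;> (push_cast; ring)
    · congr 2
      simp only [ell, hs]; push_cast; ring
  induction n with
  | zero =>
    rw [add_zero, block r s le_rfl hr le_rfl (by omega)]
    simp
  | succ n ih =>
    have h1 : μ.rowLen (r + 1 + n + 1) ≤ μ.rowLen (r + 1 + n) := μ.rowLen_anti _ _ (by omega)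
    have h2 : μ.rowLen (r + 1 + n) ≤ s := (μ.rowLen_anti (r + 1) _ (by omega)).trans hr
    rw [← add_assoc, ← Finset.prod_Ico_consecutive _ h1 h2, ih,
      block (r + 1 + n) _ (by omega) h1 h2 le_rfl,
      Finset.prod_Ico_succ_top (show r + 1 ≤ r + 1 + n + 1 by omega),
      Finset.prod_Ico_succ_top (show r + 1 ≤ r + 1 + n by omega) (fun p => br (ell μ r - ell μ p)),
      show ((s : ℤ) + 1 + ↑(r + 1 + n) - ↑r - ↑(μ.rowLen (r + 1 + n))) = ell μ r - ell μ (r + 1 + n) by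
        simp only [ell, hs]; push_cast; ring]
    rw [div_mul_div_comm]
    congr 1 <;> ring

noncomputable def ratioR (μ : YoungDiagram) (r : ℕ) : F2 :=
  br (ell μ r - 1 + μ.colLen 0) *
      ∏ j ∈ (range (μ.colLen 0)).erase r, (br (ell μ r - 1 - ell μ j) / br (ell μ r - ell μ j))

theorem rowLen_colLen (μ : YoungDiagram) : μ.rowLen (μ.colLen 0) = 0 := by
  by_contra h
  have := YoungDiagram.mem_iff_lt_colLen.1 (YoungDiagram.mem_iff_lt_rowLen.2 (Nat.pos_of_ne_zero h))
  omega

theorem lt_colLen (μ : YoungDiagram) {r : ℕ} : r < μ.colLen 0 ↔ 0 < μ.rowLen r := by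
  rw [← YoungDiagram.mem_iff_lt_colLen, YoungDiagram.mem_iff_lt_rowLen]

theorem ratio_eq (μ : YoungDiagram) (r s : ℕ) (hs : μ.rowLen r = s + 1) (hr : μ.rowLen (r + 1) ≤ s) :
    ratioR μ r = br 1 *
      (∏ j ∈ range s, (br (hookLen μ (r, j)) / br (hookLen μ (r, j) - 1))) *
      ∏ i ∈ range r, (br (hookLen μ (i, s)) / br (hookLen μ (i, s) - 1)) := by
  have hN : r < μ.colLen 0 := (lt_colLen μ).2 (by omega)
  obtain ⟨n, hn⟩ := Nat.exists_eq_add_of_le (Nat.succ_le_of_lt hN)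
  have hn' : μ.colLen 0 = r + 1 + n := hn
  have h0 := rowLen_colLen μ
  have t := row_tele μ r s hs hr n
  have hl : ell μ (r + 1 + n) = -(μ.colLen 0 : ℤ) := by
    rw [← hn', ell, h0]; simp
  rw [← hn', h0, ← Finset.range_eq_Ico, hn', Finset.prod_Ico_succ_top (show r + 1 ≤ r + 1 + n by omega), hl] at t
  rw [t]
  have c : ∏ i ∈ range r, (br (hookLen μ (i, s)) / br (hookLen μ (i, s) - 1)) =
      ∏ i ∈ range r, (br (ell μ r - 1 - ell μ i) / br (ell μ r - ell μ i)) := by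
    apply Finset.prod_congr rfl
    intro i hi
    have hi := mem_range.1 hi
    have hmem : (i, s) ∈ μ := YoungDiagram.mem_iff_lt_rowLen.2 (by have := μ.rowLen_anti i r hi.le; omega)
    have e := colLen_block μ (i := r) (j := s) (by omega) hr
    rw [hook_cast μ hmem, e, ← neg_div_neg_eq, ← br_neg, ← br_neg]
    simp only [ell, hs]
    congr 2 <;> (push_cast; ring)
  have es : (range (μ.colLen 0)).erase r = range r ∪ Ico (r + 1) (r + 1 + n) := by
    ext x; simp; omega
  have ed : Disjoint (range r) (Ico (r + 1) (r + 1 + n)) := by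
    rw [Finset.disjoint_left]; intro x; simp; omega
  rw [c, ratioR, es, Finset.prod_union ed, Finset.prod_div_distrib (s := Ico _ _)]
  have b1 : br 1 ≠ 0 := br_ne 1 (by norm_num)
  have b2 : ∏ p ∈ Ico (r + 1) (r + 1 + n), br (ell μ r - ell μ p) ≠ 0 := by
    rw [Finset.prod_ne_zero_iff]
    intro p hp
    have := ell_lt μ (i := r) (j := p) (by have := mem_Ico.1 hp; omega)
    exact br_ne _ (by omega)
  rw [sub_neg_eq_add]
  field_simp

theorem hook_prod (μ l : YoungDiagram) (r s : ℕ) (hs : μ.rowLen r = s + 1) (hr : μ.rowLen (r + 1) ≤ s)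
    (hl : l.cells = μ.cells.erase (r, s)) :
    ∏ c ∈ μ.cells, br (hookLen μ c) = (∏ c ∈ l.cells, br (hookLen l c)) * ratioR μ r := by
  have hc := colLen_block μ (i := r) (j := s) (by omega) hr
  have hmem : (r, s) ∈ μ := YoungDiagram.mem_iff_lt_rowLen.2 (by omega)
  have ml : ∀ i j, (i, j) ∈ l ↔ (i, j) ∈ μ ∧ ¬ (i = r ∧ j = s) := by
    intro i j
    rw [← YoungDiagram.mem_cells, hl, Finset.mem_erase, YoungDiagram.mem_cells]
    simp [Prod.ext_iff, and_comm]
  have rl : ∀ i, l.rowLen i = if i = r then s else μ.rowLen i := by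
    intro i
    apply eq_of_forall_lt_iff
    intro j
    rw [← YoungDiagram.mem_iff_lt_rowLen, ml, YoungDiagram.mem_iff_lt_rowLen]
    split_ifs with h
    · subst h; omega
    · simp [h]
  have cl : ∀ j, l.colLen j = if j = s then r else μ.colLen j := by
    intro j
    apply eq_of_forall_lt_iff
    intro i
    rw [← YoungDiagram.mem_iff_lt_colLen, ml, YoungDiagram.mem_iff_lt_colLen]
    split_ifs with h
    · subst h; omega
    · simp [h]
  rw [ratio_eq μ r s hs hr, ← Finset.mul_prod_erase μ.cells _ (YoungDiagram.mem_cells _ |>.2 hmem), ← hl]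
  have h1 : (hookLen μ (r, s) : ℤ) = 1 := by
    rw [hook_cast μ hmem, hs, hc]; push_cast; ring
  have hk : ∀ c ∈ l.cells, br (hookLen μ c) = br (hookLen l c) *
      ((if c.1 = r then (br (hookLen μ c) / br (hookLen μ c - 1)) else 1) *
      (if c.2 = s then (br (hookLen μ c) / br (hookLen μ c - 1)) else 1)) := by
    rintro ⟨i, j⟩ hc'
    have hm := (YoungDiagram.mem_cells _).1 hc'
    have hm2 := (ml i j).1 hm
    have e1 := hook_cast l hm
    have e2 := hook_cast μ hm2.1
    have p1 : 0 < hookLen l (i, j) := Nat.succ_pos _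
    rw [rl, cl] at e1
    have fin : (hookLen μ (i, j) : ℤ) - 1 = hookLen l (i, j) →
        br (hookLen μ (i, j)) = br (hookLen l (i, j)) * (br (hookLen μ (i, j)) / br (hookLen μ (i, j) - 1)) := by
      intro h
      rw [h, mul_div_cancel₀]
      exact br_ne _ (by omega)
    by_cases hi : i = r
    · have hj : j ≠ s := fun h => hm2.2 ⟨hi, h⟩
      simp only [hi, hj, if_true, if_false, mul_one]
      subst hi
      apply fin
      simp only [hj, if_true, if_false] at e1
      omega
    · by_cases hj : j = s
      · simp only [hi, hj, if_true, if_false, one_mul]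
        subst hj
        apply fin
        simp only [hi, if_true, if_false] at e1
        omega
      · simp only [hi, hj, if_false, mul_one] at e1 ⊢
        rw [e1, e2]
  rw [Finset.prod_congr rfl hk, Finset.prod_mul_distrib, Finset.prod_mul_distrib, h1,
    ← Finset.prod_filter, ← Finset.prod_filter]
  have f1 : l.cells.filter (fun c => c.1 = r) = (range s).image (fun j => (r, j)) := by
    ext ⟨i, j⟩
    simp only [mem_filter, YoungDiagram.mem_cells, mem_image, mem_range, Prod.mk.injEq]
    rw [YoungDiagram.mem_iff_lt_rowLen, rl]
    constructor
    · rintro ⟨h, rfl⟩; exact ⟨j, by simpa using h, rfl, rfl⟩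
    · rintro ⟨j, h, rfl, rfl⟩; simpa using h
  have f2 : l.cells.filter (fun c => c.2 = s) = (range r).image (fun i => (i, s)) := by
    ext ⟨i, j⟩
    simp only [mem_filter, YoungDiagram.mem_cells, mem_image, mem_range, Prod.mk.injEq]
    rw [YoungDiagram.mem_iff_lt_colLen, cl]
    constructor
    · rintro ⟨h, rfl⟩; exact ⟨i, by simpa using h, rfl, rfl⟩
    · rintro ⟨j, h, rfl, rfl⟩; simpa using h
  rw [f1, f2, Finset.prod_image (by intro a _ b _ h; simpa using h),
    Finset.prod_image (by intro a _ b _ h; simpa using h)]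
  ring

theorem content_sum (μ : YoungDiagram) : (vt - vt⁻¹) * contentPolyT2 μ =
    vt⁻¹ * ∑ i ∈ range (μ.colLen 0), (vt ^ (2 * ell μ i) - vt ^ (-2 * (i : ℤ))) := by
  have hv := vt_ne
  rw [contentPolyT2, Finset.sum_finset_product μ.cells (range (μ.colLen 0)) (fun i => range (μ.rowLen i)),
    Finset.mul_sum, Finset.mul_sum]
  · apply Finset.sum_congr rfl
    intro i _
    rw [ell]
    generalize μ.rowLen i = m
    induction m with
    | zero => simp
    | succ m ih =>
      rw [Finset.sum_range_succ, mul_add, ih, cellContent]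
      have : vt ^ (2 * (((m + 1 : ℕ) : ℤ) - i)) = vt ^ (2 * ((m : ℤ) - i)) * vt ^ 2 := by
        rw [← zpow_natCast, ← zpow_add₀ hv]; congr 1; push_cast; ring
      rw [this]
      field_simp
      ring
  · rintro ⟨i, j⟩
    simp only [YoungDiagram.mem_cells, mem_range, lt_colLen]
    rw [YoungDiagram.mem_iff_lt_rowLen]
    omega

theorem psi_eq (γ : F2) (l : YoungDiagram) : psiUnknot' γ l = γ ^ l.card *
    ((∏ c ∈ l.cells, (va * vt ^ cellContent c - va⁻¹ * vt ^ (-cellContent c))) /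
      ∏ c ∈ l.cells, br (hookLen l c)) := by
  rw [psiUnknot', Finset.prod_div_distrib]; rfl

theorem hprod_ne (l : YoungDiagram) : ∏ c ∈ l.cells, br (hookLen l c) ≠ 0 := by
  rw [Finset.prod_ne_zero_iff]
  intro c _
  exact br_ne _ (by have : 0 < hookLen l c := Nat.succ_pos _; omega)

theorem psi_step (γ : F2) (μ l : YoungDiagram) (r s : ℕ) (hs : μ.rowLen r = s + 1) (hr : μ.rowLen (r + 1) ≤ s)
    (hl : l.cells = μ.cells.erase (r, s)) :
    γ * ((va * vt ^ (2 * newContent l μ) - va⁻¹) * psiUnknot' γ l) =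
      vt ^ (ell μ r - 1) * ratioR μ r * psiUnknot' γ μ := by
  have hv := vt_ne
  have hmem : (r, s) ∈ μ.cells := (YoungDiagram.mem_cells _).2 (YoungDiagram.mem_iff_lt_rowLen.2 (by omega))
  have hcard : μ.card = l.card + 1 := by
    have := Finset.card_erase_add_one hmem
    rw [← hl] at this
    exact this.symm
  have hnc : newContent l μ = ell μ r - 1 := by
    rw [newContent, hl, Finset.sdiff_erase hmem]
    simp [cellContent, ell, hs]; ring
  have hcc : cellContent (r, s) = ell μ r - 1 := by simp [cellContent, ell, hs]; ring
  have hp := hook_prod μ l r s hs hr hl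
  have n1 := hprod_ne μ
  have n2 := hprod_ne l
  have n3 : ratioR μ r ≠ 0 := fun h => n1 (by rw [hp, h, mul_zero])
  rw [psi_eq, psi_eq, hp, hcard, ← Finset.mul_prod_erase μ.cells _ hmem, ← hl, hcc, hnc]
  generalize ∏ c ∈ l.cells, br (hookLen l c) = H at *
  generalize ∏ c ∈ l.cells, (va * vt ^ cellContent c - va⁻¹ * vt ^ (-cellContent c)) = P
  generalize ell μ r - 1 = e
  have : va * vt ^ (2 * e) - va⁻¹ = vt ^ e * (va * vt ^ e - va⁻¹ * vt ^ (-e)) := by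
    rw [two_mul, zpow_add₀ hv, zpow_neg]
    have := zpow_ne_zero e hv
    generalize vt ^ e = x at *
    generalize va⁻¹ = b
    field_simp
  rw [this]
  generalize (va * vt ^ e - va⁻¹ * vt ^ (-e)) = Q
  field_simp
  ring

def remC (μ : YoungDiagram) (r : ℕ) : YoungDiagram :=
  if h : μ.rowLen (r + 1) < μ.rowLen r then
    { cells := μ.cells.erase (r, μ.rowLen r - 1)
      isLowerSet := by
        rintro ⟨i, j⟩ ⟨i', j'⟩ hle hm
        obtain ⟨h1, h2⟩ := Prod.mk_le_mk.1 hle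
        rw [Finset.mem_coe, Finset.mem_erase] at hm ⊢
        refine ⟨?_, μ.isLowerSet hle hm.2⟩
        intro heq
        obtain ⟨rfl, rfl⟩ := Prod.mk.inj heq
        apply hm.1
        have hj := YoungDiagram.mem_iff_lt_rowLen.1 ((YoungDiagram.mem_cells _).1 hm.2)
        have hi : i = i' := by
          by_contra hne
          have := μ.rowLen_anti (i' + 1) i (by omega)
          omega
        subst hi
        rw [Prod.mk.injEq]
        omega }
  else ⊥

theorem remC_cells (μ : YoungDiagram) (r : ℕ) (h : μ.rowLen (r + 1) < μ.rowLen r) :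
    (remC μ r).cells = μ.cells.erase (r, μ.rowLen r - 1) := by
  rw [remC, dif_pos h]

theorem addCell_iff (μ l : YoungDiagram) :
    AddCell l μ ↔ ∃ r, μ.rowLen (r + 1) < μ.rowLen r ∧ remC μ r = l := by
  constructor
  · rintro ⟨hsub, hcard⟩
    have : (μ.cells \ l.cells).card = 1 := by
      rw [Finset.card_sdiff_of_subset hsub]
      change μ.card - l.card = 1
      omega
    obtain ⟨⟨r, j⟩, hc⟩ := Finset.card_eq_one.1 this
    have hm : (r, j) ∈ μ.cells ∧ (r, j) ∉ l.cells := by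
      rw [← Finset.mem_sdiff, hc]; simp
    have hl : l.cells = μ.cells.erase (r, j) := by
      rw [← Finset.sdiff_sdiff_eq_self hsub, hc, Finset.sdiff_singleton_eq_erase]
    have key : ∀ i' j', (i', j') ≠ (r, j) → r ≤ i' → j ≤ j' → (i', j') ∉ μ := by
      intro i' j' hne h1 h2 hin
      apply hm.2
      have : (i', j') ∈ l.cells := by rw [hl, Finset.mem_erase]; exact ⟨hne, hin⟩
      exact l.isLowerSet (Prod.mk_le_mk.2 ⟨h1, h2⟩) this
    have k1 := key r (j + 1) (by simp) le_rfl (by omega)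
    have k2 := key (r + 1) j (by simp) (by omega) le_rfl
    have k0 := (YoungDiagram.mem_cells _).1 hm.1
    rw [YoungDiagram.mem_iff_lt_rowLen] at k0 k1 k2
    have hlt : μ.rowLen (r + 1) < μ.rowLen r := by omega
    refine ⟨r, hlt, ?_⟩
    apply YoungDiagram.ext
    rw [remC_cells μ r hlt, hl, show μ.rowLen r - 1 = j by omega]
  · rintro ⟨r, h, rfl⟩
    have hmem : (r, μ.rowLen r - 1) ∈ μ.cells :=
      (YoungDiagram.mem_cells _).2 (YoungDiagram.mem_iff_lt_rowLen.2 (by omega))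
    refine ⟨?_, ?_⟩
    · rw [remC_cells μ r h]; exact Finset.erase_subset _ _
    · have := Finset.card_erase_add_one hmem
      rw [← remC_cells μ r h] at this
      exact this.symm

theorem remC_inj (μ : YoungDiagram) : Set.InjOn (remC μ) {r | μ.rowLen (r + 1) < μ.rowLen r} := by
  intro a ha b hb h
  have ha' : μ.rowLen (a + 1) < μ.rowLen a := ha
  have h' := congrArg YoungDiagram.cells h
  rw [remC_cells μ a ha, remC_cells μ b hb] at h'
  have hmem : (a, μ.rowLen a - 1) ∈ μ.cells :=
      (YoungDiagram.mem_cells _).2 (YoungDiagram.mem_iff_lt_rowLen.2 (by omega))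
  by_contra hne
  have : (a, μ.rowLen a - 1) ∈ μ.cells.erase (b, μ.rowLen b - 1) := by
    rw [Finset.mem_erase]; exact ⟨by simp [hne], hmem⟩
  rw [← h'] at this
  simp at this

theorem ratio_zero (μ : YoungDiagram) (r : ℕ) (hr : r < μ.colLen 0) (h : ¬ μ.rowLen (r + 1) < μ.rowLen r) :
    ratioR μ r = 0 := by
  have h1 := (lt_colLen μ).1 hr
  have h2 : r + 1 < μ.colLen 0 := (lt_colLen μ).2 (by omega)
  have h3 := μ.rowLen_anti r (r + 1) (by omega)
  rw [ratioR]
  apply mul_eq_zero_of_right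
  apply Finset.prod_eq_zero (i := r + 1)
  · simp [h2]
  · rw [show ell μ r - 1 - ell μ (r + 1) = 0 by simp only [ell]; push_cast; omega, br_zero, zero_div]


/-- The function `ψ'` solves the second skein-valued recursion for the unknot
conormal, in the basis `W_λ`: `ψ'_∅ = 1` and for every nonempty `μ`,
`(t - t⁻¹)·C_μ(t)·ψ'_μ = γ·Σ_{λ+□=μ} (a t^{2c(μ∖λ)} - a⁻¹)·ψ'_λ`. -/
theorem unknot_recursion_solution' (γ : F2) :
    psiUnknot' γ ⊥ = 1 ∧
    ∀ μ : YoungDiagram, μ.cells.Nonempty →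
      (vt - vt⁻¹) * contentPolyT2 μ * psiUnknot' γ μ =
        γ * ∑ᶠ l ∈ {l : YoungDiagram | AddCell l μ},
          (va * vt ^ (2 * newContent l μ) - va⁻¹) * psiUnknot' γ l := by
  refine ⟨by simp [psiUnknot', YoungDiagram.card], fun μ _ => ?_⟩
  have hbij : Set.BijOn (remC μ)
      (((range (μ.colLen 0)).filter (fun r => μ.rowLen (r + 1) < μ.rowLen r) : Finset ℕ) : Set ℕ)
      {l : YoungDiagram | AddCell l μ} := by
    refine ⟨?_, ?_, ?_⟩
    · intro r hr
      exact (addCell_iff μ _).2 ⟨r, (mem_filter.1 hr).2, rfl⟩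
    · exact (remC_inj μ).mono fun r hr => (mem_filter.1 hr).2
    · intro l hl
      obtain ⟨r, h, rfl⟩ := (addCell_iff μ l).1 hl
      exact ⟨r, mem_filter.2 ⟨mem_range.2 ((lt_colLen μ).2 (by omega)), h⟩, rfl⟩
  rw [← finsum_mem_eq_of_bijOn (f := fun r => (va * vt ^ (2 * newContent (remC μ r) μ) - va⁻¹) *
      psiUnknot' γ (remC μ r)) (remC μ) hbij (fun _ _ => rfl), finsum_mem_coe_finset, Finset.mul_sum,
    content_sum, ← sum_identity _ _ (ell_inj μ).injOn, Finset.sum_mul, Finset.sum_filter]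
  apply Finset.sum_congr rfl
  intro r hr
  split_ifs with h
  · rw [psi_step γ μ (remC μ r) r (μ.rowLen r - 1) (by omega) (by omega) (remC_cells μ r h)]
    rfl
  · have := ratio_zero μ r (mem_range.1 hr) h
    rw [ratioR] at this
    rw [this]; simp
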